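/- arXiv:2201.04928 — 8 statements merged into one kernel-verified Lean document; each statement's English description precedes it below -/
import Mathlib

section
/- Let X, Y be real Hilbert spaces, A, V : X → Y bounded linear operators, γ_G > 0, and let G : X → ℝ be γ_G-strongly convex and F* : Y → ℝ be convex. Suppose x*, x̂ ∈ X and y*, ŷ ∈ Y satisfy: −A*y* is a subgradient of G at x*, A x* is a subgradient of F* at y*, −V*ŷ is a subgradient of G at x̂, and A x̂ is a subgradient of F* at ŷ. Then ‖x* − x̂‖ ≤ (1/γ_G) · ‖V*ŷ − A*ŷ‖. -/
open scoped RealInnerProductSpace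

/-- `g` is a subgradient of `f : E → ℝ` at `x`. -/
def HasSubgradientAt {E : Type*} [NormedAddCommGroup E] [InnerProductSpace ℝ E]
    (f : E → ℝ) (g x : E) : Prop :=
  ∀ u, f x + ⟪g, u - x⟫ ≤ f u

/-- `f` is `γ`-strongly convex: `u ↦ f u - γ/2 * ‖u‖²` is convex. -/
def StronglyConvexWith {E : Type*} [NormedAddCommGroup E] [InnerProductSpace ℝ E]
    (γ : ℝ) (f : E → ℝ) : Prop :=
  ConvexOn ℝ Set.univ (fun u => f u - γ / 2 * ‖u‖ ^ 2)

theorem strong_subgrad_ineq {E : Type*} [NormedAddCommGroup E] [InnerProductSpace ℝ E]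
    {γ : ℝ} (hγ : 0 < γ) {f : E → ℝ} (hf : StronglyConvexWith γ f) {g x : E}
    (hg : HasSubgradientAt f g x) (u : E) :
    f x + ⟪g, u - x⟫ + γ / 2 * ‖u - x‖ ^ 2 ≤ f u := by
  have hs : StrongConvexOn Set.univ γ f := strongConvexOn_iff_convex.2 hf
  have key : ∀ t : ℝ, 0 < t → t < 1 →
      (γ / 2 * ‖u - x‖ ^ 2) * (1 - t) ≤ f u - f x - ⟪g, u - x⟫ := by
    intro t ht ht1
    have h := hs.2 (Set.mem_univ u) (Set.mem_univ x) ht.le (sub_nonneg.2 ht1.le) (by ring)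
    have h' := hg (t • u + (1 - t) • x)
    have e : t • u + (1 - t) • x - x = t • (u - x) := by module
    rw [e, inner_smul_right] at h'
    simp only [smul_eq_mul] at h
    have : t * ((γ / 2 * ‖u - x‖ ^ 2) * (1 - t)) ≤ t * (f u - f x - ⟪g, u - x⟫) := by
      linarith
    exact le_of_mul_le_mul_left this ht
  have hc : 0 ≤ γ / 2 * ‖u - x‖ ^ 2 := by positivity
  generalize γ / 2 * ‖u - x‖ ^ 2 = c at key hc ⊢
  by_contra hlt
  push Not at hlt
  have hhalf := key (1 / 2) (by norm_num) (by norm_num)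
  set B := f u - f x - ⟪g, u - x⟫ with hB
  have hBc : B < c := by linarith
  have hc0 : 0 < c := by linarith
  have := key ((c - B) / (2 * c)) (div_pos (by linarith) (by linarith))
    ((div_lt_one (by linarith)).2 (by linarith))
  have e : c * (1 - (c - B) / (2 * c)) = (c + B) / 2 := by
    field_simp
    ring
  linarith

theorem statement0 {X Y : Type*}
    [NormedAddCommGroup X] [InnerProductSpace ℝ X] [CompleteSpace X]
    [NormedAddCommGroup Y] [InnerProductSpace ℝ Y] [CompleteSpace Y]
    (A V : X →L[ℝ] Y) (γG : ℝ) (hγG : 0 < γG)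
    (G : X → ℝ) (Fstar : Y → ℝ)
    (hG : StronglyConvexWith γG G)
    (hFstar : ConvexOn ℝ Set.univ Fstar)
    (xs xh : X) (ys yh : Y)
    (h1 : HasSubgradientAt G (-(ContinuousLinearMap.adjoint A ys)) xs)
    (h2 : HasSubgradientAt Fstar (A xs) ys)
    (h3 : HasSubgradientAt G (-(ContinuousLinearMap.adjoint V yh)) xh)
    (h4 : HasSubgradientAt Fstar (A xh) yh) :
    ‖xs - xh‖ ≤
      (1 / γG) * ‖ContinuousLinearMap.adjoint V yh - ContinuousLinearMap.adjoint A yh‖ := by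
  have a := strong_subgrad_ineq hγG hG h1 xh
  have b := strong_subgrad_ineq hγG hG h3 xs
  have c := h2 yh
  have d := h4 ys
  have hn : ‖xh - xs‖ = ‖xs - xh‖ := norm_sub_rev _ _
  rw [hn] at a
  have cs := real_inner_le_norm
    (ContinuousLinearMap.adjoint V yh - ContinuousLinearMap.adjoint A yh) (xs - xh)
  simp only [inner_sub_left, inner_sub_right, inner_neg_left,
    ContinuousLinearMap.adjoint_inner_left] at a b c d cs
  rw [real_inner_comm yh (A xs), real_inner_comm ys (A xs)] at *
  rw [real_inner_comm yh (A xh), real_inner_comm ys (A xh)] at *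
  rw [one_div, inv_mul_eq_div, le_div_iff₀ hγG]
  rcases (norm_nonneg (xs - xh)).eq_or_lt with h0 | h0
  · rw [← h0]; simp
  · refine le_of_mul_le_mul_right ?_ h0
    nlinarith
end

section
/- Let U be a real Hilbert space, N ≥ 1 a natural number, and for each i ∈ ℕ let M_{i+1}, W_{i+1}, Z_{i+1} be bounded linear operators on U. Let (u^i)_{i∈ℕ} ⊂ U, û ∈ U, (h^{i+1})_{i∈ℕ} ⊂ U and (Δ_{i+1})_{i∈ℕ} ⊂ ℝ be such that for every i: (a) W_{i+1} h^{i+1} + M_{i+1}(u^{i+1} − u^i) = 0; (b) the operator Z_{i+1}M_{i+1} is self-adjoint; (c) ⟨Z_{i+1}W_{i+1} h^{i+1}, u^{i+1} − û⟩ ≥ ½⟨(Z_{i+2}M_{i+2} − Z_{i+1}M_{i+1})(u^{i+1} − û), u^{i+1} − û⟩ − ½⟨Z_{i+1}M_{i+1}(u^{i+1} − u^i), u^{i+1} − u^i⟩ − Δ_{i+1}. Then ½⟨Z_{N+1}M_{N+1}(u^N − û), u^N − û⟩ ≤ ½⟨Z_1M_1(u^0 − û), u^0 − û⟩ + Σ_{i=0}^{N−1}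 Δ_{i+1}. -/
open scoped RealInnerProductSpace

theorem statement2 {U : Type*} [NormedAddCommGroup U] [InnerProductSpace ℝ U] [CompleteSpace U]
    (N : ℕ) (hN : 1 ≤ N)
    (M W Z : ℕ → (U →L[ℝ] U))
    (u : ℕ → U) (uh : U) (h : ℕ → U) (Δ : ℕ → ℝ)
    (ha : ∀ i : ℕ, W (i + 1) (h (i + 1)) + M (i + 1) (u (i + 1) - u i) = 0)
    (hb : ∀ i : ℕ, IsSelfAdjoint ((Z (i + 1)).comp (M (i + 1))))
    (hc : ∀ i : ℕ,
      ⟪Z (i + 1) (W (i + 1) (h (i + 1))), u (i + 1) - uh⟫ ≥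
        (1 / 2) * ⟪((Z (i + 2)).comp (M (i + 2)) - (Z (i + 1)).comp (M (i + 1)))
            (u (i + 1) - uh), u (i + 1) - uh⟫
          - (1 / 2) * ⟪Z (i + 1) (M (i + 1) (u (i + 1) - u i)), u (i + 1) - u i⟫
          - Δ (i + 1)) :
    (1 / 2) * ⟪Z (N + 1) (M (N + 1) (u N - uh)), u N - uh⟫ ≤
      (1 / 2) * ⟪Z 1 (M 1 (u 0 - uh)), u 0 - uh⟫ + ∑ i ∈ Finset.range N, Δ (i + 1) := by
  clear hN
  induction N with
  | zero => simp
  | succ n ih =>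
    rw [Finset.sum_range_succ]
    have h1 := hc n
    have hW : W (n + 1) (h (n + 1)) = - M (n + 1) (u (n + 1) - u n) :=
      eq_neg_of_add_eq_zero_left (ha n)
    rw [hW] at h1
    have hy : u n - uh = (u (n + 1) - uh) - (u (n + 1) - u n) := by abel
    rw [hy] at ih
    generalize ⟪Z 1 (M 1 (u 0 - uh)), u 0 - uh⟫ = c at ih ⊢
    rw [show n + 1 + 1 = n + 2 from rfl]
    generalize u (n + 1) - uh = x at *
    generalize u (n + 1) - u n = d at *
    have hs : ⟪Z (n + 1) (M (n + 1) x), d⟫ = ⟪Z (n + 1) (M (n + 1) d), x⟫ := by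
      have := (hb n).isSymmetric x d
      rw [real_inner_comm]
      simpa [real_inner_comm] using this
    simp only [sub_apply, ContinuousLinearMap.comp_apply, map_sub, map_neg,
      inner_sub_left, inner_sub_right, inner_neg_left] at h1 ih
    rw [hs] at ih
    linarith
end

section
/- Let X, Y be real Hilbert spaces, A, V : X → Y bounded linear operators, ε > 0, η, η' > 0, ω = η/η', μ_G, μ_F ∈ ℝ, and γ_G, γ_F > 0 with γ_G ≥ (ε/(2ω))‖A − V‖ + μ_G. Let G : X → ℝ be γ_G-strongly convex and F* : Y → ℝ be γ_F-strongly convex. Let x⁰, x¹, x̂ ∈ X and y¹, ŷ ∈ Y and suppose g is a subgradient of G at x¹, f is a subgradient of F* at y¹, −V*ŷ is a subgradient of G at x̂, and A x̂ is a subgradient of F* at ŷ. Define D = η⟨g + V*y¹, x¹ − x̂⟩ + η'⟨f − A(x¹ + ω(x¹ − x⁰)) − ω V(x⁰ − x¹), y¹ − ŷ⟩ + (η' − η)⟨V(x¹ − x̂), y¹ − ŷ⟩ − η μ_G‖x¹ − x̂‖² − η' μ_F‖y¹ − ŷ‖². Then D ≥ η'(γ_F − μ_F − ((1 + ω)/(2ε))‖A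 − V‖)‖y¹ − ŷ‖² − (η ε ‖A − V‖/2)‖x¹ − x⁰‖². -/
open scoped RealInnerProductSpace

theorem strong_subgrad {E : Type*} [NormedAddCommGroup E] [InnerProductSpace ℝ E]
    {γ : ℝ} {f : E → ℝ} (hf : StronglyConvexWith γ f) {g x : E}
    (hg : HasSubgradientAt f g x) (u : E) :
    f x + ⟪g, u - x⟫ + γ / 2 * ‖u - x‖ ^ 2 ≤ f u := by
  have key : ∀ t : ℝ, 0 < t → t < 1 →
      f x + ⟪g, u - x⟫ + (1 - t) * (γ / 2 * ‖u - x‖ ^ 2) ≤ f u := by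
    intro t h0 h1
    have h2 := hf.2 (Set.mem_univ x) (Set.mem_univ u) (by linarith : (0:ℝ) ≤ 1 - t) h0.le
      (by ring)
    have h3 := hg ((1 - t) • x + t • u)
    have e1 : (1 - t) • x + t • u - x = t • (u - x) := by module
    rw [e1, inner_smul_right] at h3
    have e2 : ‖(1 - t) • x + t • u‖ ^ 2
        = (1 - t) * ‖x‖ ^ 2 + t * ‖u‖ ^ 2 - t * (1 - t) * ‖u - x‖ ^ 2 := by
      rw [norm_add_sq_real, norm_sub_sq_real, norm_smul, norm_smul, inner_smul_left,
        inner_smul_right, mul_pow, mul_pow, Real.norm_eq_abs, Real.norm_eq_abs, sq_abs, sq_abs,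
        real_inner_comm u x]
      simp
      ring
    simp only [smul_eq_mul] at h2
    rw [e2] at h2
    have h4 : t * (f x + ⟪g, u - x⟫ + (1 - t) * (γ / 2 * ‖u - x‖ ^ 2)) ≤ t * f u := by
      nlinarith
    exact le_of_mul_le_mul_left h4 h0
  generalize γ / 2 * ‖u - x‖ ^ 2 = c at *
  generalize ⟪g, u - x⟫ = p at *
  by_contra hcon
  push Not at hcon
  obtain ⟨e, he⟩ : ∃ e, e = f x + p + c - f u := ⟨_, rfl⟩
  have he0 : 0 < e := by linarith
  have k1 := key (1/2) (by norm_num) (by norm_num)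
  have hc : 2 * e ≤ c := by linarith
  have hc0 : 0 < c := by linarith
  have k2 := key (e / (2 * c)) (by positivity) (by rw [div_lt_one (by positivity)]; linarith)
  have : e / (2 * c) * c = e / 2 := by field_simp
  nlinarith

theorem op_young {X Y : Type*}
    [NormedAddCommGroup X] [InnerProductSpace ℝ X]
    [NormedAddCommGroup Y] [InnerProductSpace ℝ Y]
    (B : X →L[ℝ] Y) {ε : ℝ} (hε : 0 < ε) (x : X) (y : Y) :
    ⟪B x, y⟫ ≤ ‖B‖ * (ε / 2 * ‖x‖ ^ 2 + 1 / (2 * ε) * ‖y‖ ^ 2) := by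
  have h1 : ⟪B x, y⟫ ≤ ‖B‖ * (‖x‖ * ‖y‖) := by
    calc ⟪B x, y⟫ ≤ ‖B x‖ * ‖y‖ := real_inner_le_norm _ _
      _ ≤ ‖B‖ * ‖x‖ * ‖y‖ := by gcongr; exact B.le_opNorm x
      _ = _ := by ring
  refine h1.trans (mul_le_mul_of_nonneg_left ?_ (norm_nonneg _))
  have : ε / 2 * ‖x‖ ^ 2 + 1 / (2 * ε) * ‖y‖ ^ 2 - ‖x‖ * ‖y‖
      = (ε * ‖x‖ - ‖y‖) ^ 2 / (2 * ε) := by field_simp; ring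
  have : 0 ≤ (ε * ‖x‖ - ‖y‖) ^ 2 / (2 * ε) := by positivity
  linarith

theorem statement5 {X Y : Type*}
    [NormedAddCommGroup X] [InnerProductSpace ℝ X] [CompleteSpace X]
    [NormedAddCommGroup Y] [InnerProductSpace ℝ Y] [CompleteSpace Y]
    (A V : X →L[ℝ] Y)
    (ε η η' ω μG μF γG γF : ℝ)
    (hε : 0 < ε) (hη : 0 < η) (hη' : 0 < η') (hω : ω = η / η')
    (hγG : 0 < γG) (hγF : 0 < γF)
    (hγGbound : γG ≥ ε / (2 * ω) * ‖A - V‖ + μG)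
    (G : X → ℝ) (Fstar : Y → ℝ)
    (hG : StronglyConvexWith γG G)
    (hFstar : StronglyConvexWith γF Fstar)
    (x0 x1 xh : X) (y1 yh : Y) (g : X) (f : Y)
    (hg : HasSubgradientAt G g x1)
    (hf : HasSubgradientAt Fstar f y1)
    (hxh : HasSubgradientAt G (-(ContinuousLinearMap.adjoint V yh)) xh)
    (hyh : HasSubgradientAt Fstar (A xh) yh)
    (D : ℝ)
    (hD : D = η * ⟪g + ContinuousLinearMap.adjoint V y1, x1 - xh⟫
        + η' * ⟪f - A (x1 + ω • (x1 - x0)) - ω • V (x0 - x1), y1 - yh⟫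
        + (η' - η) * ⟪V (x1 - xh), y1 - yh⟫
        - η * μG * ‖x1 - xh‖ ^ 2 - η' * μF * ‖y1 - yh‖ ^ 2) :
    D ≥ η' * (γF - μF - (1 + ω) / (2 * ε) * ‖A - V‖) * ‖y1 - yh‖ ^ 2
        - η * ε * ‖A - V‖ / 2 * ‖x1 - x0‖ ^ 2 := by
  have g1 := strong_subgrad hG hg xh
  have g2 := strong_subgrad hG hxh x1
  have f1 := strong_subgrad hFstar hf yh
  have f2 := strong_subgrad hFstar hyh y1
  rw [← neg_sub x1 xh, inner_neg_right, norm_neg] at g1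
  rw [← neg_sub y1 yh, inner_neg_right, norm_neg] at f1
  rw [inner_neg_left, ContinuousLinearMap.adjoint_inner_left] at g2
  have a1 := op_young (A - V) hε (x1 - xh) (y1 - yh)
  have a2 := op_young (A - V) hε (x1 - x0) (y1 - yh)
  have hη2 : η = ω * η' := by rw [hω]; field_simp
  have hω0 : 0 < ω := by rw [hω]; positivity
  have e1 : ⟪g + ContinuousLinearMap.adjoint V y1, x1 - xh⟫
      = ⟪g, x1 - xh⟫ + ⟪yh, V (x1 - xh)⟫ + ⟪V (x1 - xh), y1 - yh⟫ := by
    rw [inner_add_left, ContinuousLinearMap.adjoint_inner_left,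
      real_inner_comm (y1 - yh) (V (x1 - xh)), inner_sub_left y1 yh]
    ring
  have e2 : ⟪f - A (x1 + ω • (x1 - x0)) - ω • V (x0 - x1), y1 - yh⟫
      = ⟪f, y1 - yh⟫ - ⟪A xh, y1 - yh⟫ - ⟪V (x1 - xh), y1 - yh⟫
        - ⟪(A - V) (x1 - xh), y1 - yh⟫ - ω * ⟪(A - V) (x1 - x0), y1 - yh⟫ := by
    simp only [map_add, map_sub, map_smul, ContinuousLinearMap.sub_apply, inner_sub_left,
      inner_add_left, real_inner_smul_left]
    ring
  rw [e1, e2] at hD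
  have hγ : 0 ≤ η * ‖x1 - xh‖ ^ 2 * (γG - (ε / (2 * ω) * ‖A - V‖ + μG)) :=
    mul_nonneg (by positivity) (by linarith)
  have e3 : η * (ε / (2 * ω)) = η' * (ε / 2) := by rw [hη2]; field_simp
  have e4 : (1 + ω) / (2 * ε) = 1 / (2 * ε) + ω * (1 / (2 * ε)) := by ring
  have G' : 0 ≤ η * (⟪g, x1 - xh⟫ + ⟪yh, V (x1 - xh)⟫ - γG * ‖x1 - xh‖ ^ 2) :=
    mul_nonneg hη.le (by linarith)
  have F' : 0 ≤ η' * (⟪f, y1 - yh⟫ - ⟪A xh, y1 - yh⟫ - γF * ‖y1 - yh‖ ^ 2) :=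
    mul_nonneg hη'.le (by linarith)
  have A1 := mul_le_mul_of_nonneg_left a1 hη'.le
  have A2 := mul_le_mul_of_nonneg_left a2 hη.le
  have hγ' : η * ‖x1 - xh‖ ^ 2 * (γG - (ε / (2 * ω) * ‖A - V‖ + μG))
      = η * γG * ‖x1 - xh‖ ^ 2 - η' * (ε / 2) * ‖A - V‖ * ‖x1 - xh‖ ^ 2
        - η * μG * ‖x1 - xh‖ ^ 2 := by
    rw [← e3]; ring
  rw [hγ'] at hγ
  rw [e4, hD]
  generalize 1 / (2 * ε) = k at *
  clear hω e3 e4 hγ' hγGbound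
  subst hη2
  linarith
end

section
/- Let X, Y be real Hilbert spaces, A, V : X → Y bounded linear operators with ‖A − V‖ > 0 and ‖V‖ > 0, and γ_G, γ_F > 0 with γ_F γ_G > 2‖A − V‖². Fix κ ∈ (0,1) and define b = min{1/2, (1/κ)(1/2 − ‖A − V‖²/(γ_F γ_G)), ((1 − κ)/κ²) · 2‖A − V‖⁴/(‖V‖² γ_F γ_G)}, τ = √((1 − κ)γ_F/(2b‖V‖² γ_G)), σ = 2b(γ_G/γ_F)τ, and ω = 1/(1 + 2bτγ_G). Let G : X → ℝ be γ_G-strongly convex and F* : Y → ℝ be γ_F-strongly convex, let (x^i) ⊂ X, (y^i) ⊂ Y satisfy: for every i, (1/τ)(x^i − x^{i+1}) − V*y^i is a subgradient of G at x^{i+1} and (1/σ)(y^i − y^{i+1}) + A(x^{i+1} + ω(x^{i+1} − x^i)) is a subgradient of F* at y^{i+1}, and let (x̂, ŷ) satisfy: −V*ŷ is a subgradient of G at x̂ and A x̂ is a subgradient of F* at ŷ. Then there exists C ≥ 0 such that for all N ∈ ℕ: ‖x^N − x̂‖² + ‖y^N − ŷ‖² ≤ C ω^N. -/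
open scoped RealInnerProductSpace

noncomputable def PP (s r : ℝ) : ℝ :=
  ((6) * r ^ 0 + (-4/5) * r ^ 1 + (-4) * r ^ 2) * s ^ 0 +
  ((157/5) * r ^ 0 + (-313/40) * r ^ 1 + (-104/5) * r ^ 2) * s ^ 1 +
  ((344/5) * r ^ 0 + (-227/10) * r ^ 1 + (-441/10) * r ^ 2) * s ^ 2 +
  ((406/5) * r ^ 0 + (-579/20) * r ^ 1 + (-242/5) * r ^ 2) * s ^ 3 +
  ((274/5) * r ^ 0 + (-171/10) * r ^ 1 + (-143/5) * r ^ 2) * s ^ 4 +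
  ((101/5) * r ^ 0 + (-153/40) * r ^ 1 + (-42/5) * r ^ 2) * s ^ 5 +
  ((16/5) * r ^ 0 + (-9/10) * r ^ 2) * s ^ 6

noncomputable def PE (s r : ℝ) : ℝ :=
  ((-46/5) * r ^ 0 + (16/5) * r ^ 1 + (22/5) * r ^ 2) * s ^ 0 +
  ((-197/5) * r ^ 0 + (329/20) * r ^ 1 + (109/5) * r ^ 2) * s ^ 1 +
  ((-323/5) * r ^ 0 + (31) * r ^ 1 + (216/5) * r ^ 2) * s ^ 2 +
  ((-247/5) * r ^ 0 + (263/10) * r ^ 1 + (214/5) * r ^ 2) * s ^ 3 +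
  ((-83/5) * r ^ 0 + (49/5) * r ^ 1 + (106/5) * r ^ 2) * s ^ 4 +
  ((-8/5) * r ^ 0 + (5/4) * r ^ 1 + (21/5) * r ^ 2) * s ^ 5

noncomputable def EE (s r : ℝ) : ℝ :=
  ((23/5) * r ^ 0 + (-57/10) * r ^ 1 + (14/5) * r ^ 2) * s ^ 0 +
  ((187/10) * r ^ 0 + (-1001/40) * r ^ 1 + (141/10) * r ^ 2) * s ^ 1 +
  ((283/10) * r ^ 0 + (-401/10) * r ^ 1 + (127/5) * r ^ 2) * s ^ 2 +
  ((96/5) * r ^ 0 + (-563/20) * r ^ 1 + (103/5) * r ^ 2) * s ^ 3 +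
  ((53/10) * r ^ 0 + (-41/5) * r ^ 1 + (37/5) * r ^ 2) * s ^ 4 +
  ((3/10) * r ^ 0 + (-5/8) * r ^ 1 + (9/10) * r ^ 2) * s ^ 5

lemma PP_pos (s r : ℝ) (hs : 0 ≤ s) (h0 : 0 ≤ r) (h1 : r ≤ 1) : 0 < PP s r := by
  unfold PP
  have c0 : 0 < ((6) * r ^ 0 + (-4/5) * r ^ 1 + (-4) * r ^ 2) := by nlinarith [mul_nonneg h0 (sub_nonneg.2 h1), sq_nonneg (r - 3/4)]
  have c1 : 0 < ((157/5) * r ^ 0 + (-313/40) * r ^ 1 + (-104/5) * r ^ 2) := by nlinarith [mul_nonneg h0 (sub_nonneg.2 h1), sq_nonneg (r - 3/4)]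
  have c2 : 0 < ((344/5) * r ^ 0 + (-227/10) * r ^ 1 + (-441/10) * r ^ 2) := by nlinarith [mul_nonneg h0 (sub_nonneg.2 h1), sq_nonneg (r - 3/4)]
  have c3 : 0 < ((406/5) * r ^ 0 + (-579/20) * r ^ 1 + (-242/5) * r ^ 2) := by nlinarith [mul_nonneg h0 (sub_nonneg.2 h1), sq_nonneg (r - 3/4)]
  have c4 : 0 < ((274/5) * r ^ 0 + (-171/10) * r ^ 1 + (-143/5) * r ^ 2) := by nlinarith [mul_nonneg h0 (sub_nonneg.2 h1), sq_nonneg (r - 3/4)]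
  have c5 : 0 < ((101/5) * r ^ 0 + (-153/40) * r ^ 1 + (-42/5) * r ^ 2) := by nlinarith [mul_nonneg h0 (sub_nonneg.2 h1), sq_nonneg (r - 3/4)]
  have c6 : 0 < ((16/5) * r ^ 0 + (-9/10) * r ^ 2) := by nlinarith [mul_nonneg h0 (sub_nonneg.2 h1), sq_nonneg (r - 3/4)]
  have := c0.le
  positivity

lemma EE_pos (s r : ℝ) (hs : 0 ≤ s) (h0 : 0 ≤ r) (h1 : r ≤ 1) : 0 < EE s r := by
  unfold EE
  have c0 : 0 < ((23/5) * r ^ 0 + (-57/10) * r ^ 1 + (14/5) * r ^ 2) := by nlinarith [mul_nonneg h0 (sub_nonneg.2 h1), sq_nonneg (r - 3/4)]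
  have c1 : 0 < ((187/10) * r ^ 0 + (-1001/40) * r ^ 1 + (141/10) * r ^ 2) := by nlinarith [mul_nonneg h0 (sub_nonneg.2 h1), sq_nonneg (r - 3/4)]
  have c2 : 0 < ((283/10) * r ^ 0 + (-401/10) * r ^ 1 + (127/5) * r ^ 2) := by nlinarith [mul_nonneg h0 (sub_nonneg.2 h1), sq_nonneg (r - 3/4)]
  have c3 : 0 < ((96/5) * r ^ 0 + (-563/20) * r ^ 1 + (103/5) * r ^ 2) := by nlinarith [mul_nonneg h0 (sub_nonneg.2 h1), sq_nonneg (r - 3/4)]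
  have c4 : 0 < ((53/10) * r ^ 0 + (-41/5) * r ^ 1 + (37/5) * r ^ 2) := by nlinarith [mul_nonneg h0 (sub_nonneg.2 h1), sq_nonneg (r - 3/4)]
  have c5 : 0 < ((3/10) * r ^ 0 + (-5/8) * r ^ 1 + (9/10) * r ^ 2) := by nlinarith [mul_nonneg h0 (sub_nonneg.2 h1), sq_nonneg (r - 3/4)]
  have := c0.le
  positivity

lemma det_c0 (r : ℝ) (h0 : 0 ≤ r) (h1 : r ≤ 1) :
    0 < ((644/25) * r ^ 0 + (-2316/25) * r ^ 1 + (2064/25) * r ^ 2 + (1352/25) * r ^ 3 + (-1604/25) * r ^ 4) := by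
  nlinarith [mul_nonneg h0 (sub_nonneg.2 h1), mul_nonneg (mul_nonneg h0 h0) (mul_nonneg h0 (sub_nonneg.2 h1)), mul_nonneg (sq_nonneg (r - 2/3)) (mul_nonneg h0 (sub_nonneg.2 h1)), mul_nonneg (sq_nonneg (1 - r)) (mul_nonneg h0 (sub_nonneg.2 h1)), sq_nonneg (r - 2/3), sq_nonneg (r * (r - 2/3)), mul_nonneg (sq_nonneg (r - 2/3)) (sub_nonneg.2 h1), mul_nonneg (sq_nonneg (r - 2/3)) h0]

lemma det_c1 (r : ℝ) (h0 : 0 ≤ r) (h1 : r ≤ 1) :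
    0 < ((1508/5) * r ^ 0 + (-1931/2) * r ^ 1 + (90921/100) * r ^ 2 + (2288/5) * r ^ 3 + (-3252/5) * r ^ 4) := by
  nlinarith [mul_nonneg h0 (sub_nonneg.2 h1), mul_nonneg (mul_nonneg h0 h0) (mul_nonneg h0 (sub_nonneg.2 h1)), mul_nonneg (sq_nonneg (r - 2/3)) (mul_nonneg h0 (sub_nonneg.2 h1)), mul_nonneg (sq_nonneg (1 - r)) (mul_nonneg h0 (sub_nonneg.2 h1)), sq_nonneg (r - 2/3), sq_nonneg (r * (r - 2/3)), mul_nonneg (sq_nonneg (r - 2/3)) (sub_nonneg.2 h1), mul_nonneg (sq_nonneg (r - 2/3)) h0]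

lemma det_c2 (r : ℝ) (h0 : 0 ≤ r) (h1 : r ≤ 1) :
    0 < ((38821/25) * r ^ 0 + (-448763/100) * r ^ 1 + (21862/5) * r ^ 2 + (168581/100) * r ^ 3 + (-73221/25) * r ^ 4) := by
  nlinarith [mul_nonneg h0 (sub_nonneg.2 h1), mul_nonneg (mul_nonneg h0 h0) (mul_nonneg h0 (sub_nonneg.2 h1)), mul_nonneg (sq_nonneg (r - 2/3)) (mul_nonneg h0 (sub_nonneg.2 h1)), mul_nonneg (sq_nonneg (1 - r)) (mul_nonneg h0 (sub_nonneg.2 h1)), sq_nonneg (r - 2/3), sq_nonneg (r * (r - 2/3)), mul_nonneg (sq_nonneg (r - 2/3)) (sub_nonneg.2 h1), mul_nonneg (sq_nonneg (r - 2/3)) h0]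

lemma det_c3 (r : ℝ) (h0 : 0 ≤ r) (h1 : r ≤ 1) :
    0 < ((116404/25) * r ^ 0 + (-245201/20) * r ^ 1 + (303892/25) * r ^ 2 + (71219/20) * r ^ 3 + (-193309/25) * r ^ 4) := by
  nlinarith [mul_nonneg h0 (sub_nonneg.2 h1), mul_nonneg (mul_nonneg h0 h0) (mul_nonneg h0 (sub_nonneg.2 h1)), mul_nonneg (sq_nonneg (r - 2/3)) (mul_nonneg h0 (sub_nonneg.2 h1)), mul_nonneg (sq_nonneg (1 - r)) (mul_nonneg h0 (sub_nonneg.2 h1)), sq_nonneg (r - 2/3), sq_nonneg (r * (r - 2/3)), mul_nonneg (sq_nonneg (r - 2/3)) (sub_nonneg.2 h1), mul_nonneg (sq_nonneg (r - 2/3)) h0]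

lemma det_c4 (r : ℝ) (h0 : 0 ≤ r) (h1 : r ≤ 1) :
    0 < ((225941/25) * r ^ 0 + (-545593/25) * r ^ 1 + (542971/25) * r ^ 2 + (119741/25) * r ^ 3 + (-332046/25) * r ^ 4) := by
  nlinarith [mul_nonneg h0 (sub_nonneg.2 h1), mul_nonneg (mul_nonneg h0 h0) (mul_nonneg h0 (sub_nonneg.2 h1)), mul_nonneg (sq_nonneg (r - 2/3)) (mul_nonneg h0 (sub_nonneg.2 h1)), mul_nonneg (sq_nonneg (1 - r)) (mul_nonneg h0 (sub_nonneg.2 h1)), sq_nonneg (r - 2/3), sq_nonneg (r * (r - 2/3)), mul_nonneg (sq_nonneg (r - 2/3)) (sub_nonneg.2 h1), mul_nonneg (sq_nonneg (r - 2/3)) h0]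

lemma det_c5 (r : ℝ) (h0 : 0 ≤ r) (h1 : r ≤ 1) :
    0 < ((297482/25) * r ^ 0 + (-105947/4) * r ^ 1 + (654036/25) * r ^ 2 + (8667/2) * r ^ 3 + (-388692/25) * r ^ 4) := by
  nlinarith [mul_nonneg h0 (sub_nonneg.2 h1), mul_nonneg (mul_nonneg h0 h0) (mul_nonneg h0 (sub_nonneg.2 h1)), mul_nonneg (sq_nonneg (r - 2/3)) (mul_nonneg h0 (sub_nonneg.2 h1)), mul_nonneg (sq_nonneg (1 - r)) (mul_nonneg h0 (sub_nonneg.2 h1)), sq_nonneg (r - 2/3), sq_nonneg (r * (r - 2/3)), mul_nonneg (sq_nonneg (r - 2/3)) (sub_nonneg.2 h1), mul_nonneg (sq_nonneg (r - 2/3)) h0]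

lemma det_c6 (r : ℝ) (h0 : 0 ≤ r) (h1 : r ≤ 1) :
    0 < ((269861/25) * r ^ 0 + (-556351/25) * r ^ 1 + (540891/25) * r ^ 2 + (137669/50) * r ^ 3 + (-315116/25) * r ^ 4) := by
  nlinarith [mul_nonneg h0 (sub_nonneg.2 h1), mul_nonneg (mul_nonneg h0 h0) (mul_nonneg h0 (sub_nonneg.2 h1)), mul_nonneg (sq_nonneg (r - 2/3)) (mul_nonneg h0 (sub_nonneg.2 h1)), mul_nonneg (sq_nonneg (1 - r)) (mul_nonneg h0 (sub_nonneg.2 h1)), sq_nonneg (r - 2/3), sq_nonneg (r * (r - 2/3)), mul_nonneg (sq_nonneg (r - 2/3)) (sub_nonneg.2 h1), mul_nonneg (sq_nonneg (r - 2/3)) h0]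

lemma det_c7 (r : ℝ) (h0 : 0 ≤ r) (h1 : r ≤ 1) :
    0 < ((167296/25) * r ^ 0 + (-1285139/100) * r ^ 1 + (306364/25) * r ^ 2 + (32422/25) * r ^ 3 + (-175746/25) * r ^ 4) := by
  nlinarith [mul_nonneg h0 (sub_nonneg.2 h1), mul_nonneg (mul_nonneg h0 h0) (mul_nonneg h0 (sub_nonneg.2 h1)), mul_nonneg (sq_nonneg (r - 2/3)) (mul_nonneg h0 (sub_nonneg.2 h1)), mul_nonneg (sq_nonneg (1 - r)) (mul_nonneg h0 (sub_nonneg.2 h1)), sq_nonneg (r - 2/3), sq_nonneg (r * (r - 2/3)), mul_nonneg (sq_nonneg (r - 2/3)) (sub_nonneg.2 h1), mul_nonneg (sq_nonneg (r - 2/3)) h0]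

lemma det_c8 (r : ℝ) (h0 : 0 ≤ r) (h1 : r ≤ 1) :
    0 < ((68479/25) * r ^ 0 + (-123656/25) * r ^ 1 + (116263/25) * r ^ 2 + (12007/25) * r ^ 3 + (-65334/25) * r ^ 4) := by
  nlinarith [mul_nonneg h0 (sub_nonneg.2 h1), mul_nonneg (mul_nonneg h0 h0) (mul_nonneg h0 (sub_nonneg.2 h1)), mul_nonneg (sq_nonneg (r - 2/3)) (mul_nonneg h0 (sub_nonneg.2 h1)), mul_nonneg (sq_nonneg (1 - r)) (mul_nonneg h0 (sub_nonneg.2 h1)), sq_nonneg (r - 2/3), sq_nonneg (r * (r - 2/3)), mul_nonneg (sq_nonneg (r - 2/3)) (sub_nonneg.2 h1), mul_nonneg (sq_nonneg (r - 2/3)) h0]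

lemma det_c9 (r : ℝ) (h0 : 0 ≤ r) (h1 : r ≤ 1) :
    0 < ((17166/25) * r ^ 0 + (-118863/100) * r ^ 1 + (22567/20) * r ^ 2 + (6913/50) * r ^ 3 + (-15096/25) * r ^ 4) := by
  nlinarith [mul_nonneg h0 (sub_nonneg.2 h1), mul_nonneg (mul_nonneg h0 h0) (mul_nonneg h0 (sub_nonneg.2 h1)), mul_nonneg (sq_nonneg (r - 2/3)) (mul_nonneg h0 (sub_nonneg.2 h1)), mul_nonneg (sq_nonneg (1 - r)) (mul_nonneg h0 (sub_nonneg.2 h1)), sq_nonneg (r - 2/3), sq_nonneg (r * (r - 2/3)), mul_nonneg (sq_nonneg (r - 2/3)) (sub_nonneg.2 h1), mul_nonneg (sq_nonneg (r - 2/3)) h0]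

lemma det_c10 (r : ℝ) (h0 : 0 ≤ r) (h1 : r ≤ 1) :
    0 < ((2238/25) * r ^ 0 + (-3121/20) * r ^ 1 + (3993/25) * r ^ 2 + (105/4) * r ^ 3 + (-1863/25) * r ^ 4) := by
  nlinarith [mul_nonneg h0 (sub_nonneg.2 h1), mul_nonneg (mul_nonneg h0 h0) (mul_nonneg h0 (sub_nonneg.2 h1)), mul_nonneg (sq_nonneg (r - 2/3)) (mul_nonneg h0 (sub_nonneg.2 h1)), mul_nonneg (sq_nonneg (1 - r)) (mul_nonneg h0 (sub_nonneg.2 h1)), sq_nonneg (r - 2/3), sq_nonneg (r * (r - 2/3)), mul_nonneg (sq_nonneg (r - 2/3)) (sub_nonneg.2 h1), mul_nonneg (sq_nonneg (r - 2/3)) h0]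

lemma det_c11 (r : ℝ) (h0 : 0 ≤ r) (h1 : r ≤ 1) :
    0 < ((96/25) * r ^ 0 + (-8) * r ^ 1 + (261/25) * r ^ 2 + (9/4) * r ^ 3 + (-81/25) * r ^ 4) := by
  nlinarith [mul_nonneg h0 (sub_nonneg.2 h1), mul_nonneg (mul_nonneg h0 h0) (mul_nonneg h0 (sub_nonneg.2 h1)), mul_nonneg (sq_nonneg (r - 2/3)) (mul_nonneg h0 (sub_nonneg.2 h1)), mul_nonneg (sq_nonneg (1 - r)) (mul_nonneg h0 (sub_nonneg.2 h1)), sq_nonneg (r - 2/3), sq_nonneg (r * (r - 2/3)), mul_nonneg (sq_nonneg (r - 2/3)) (sub_nonneg.2 h1), mul_nonneg (sq_nonneg (r - 2/3)) h0]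

lemma det_pos (s r : ℝ) (hs : 0 ≤ s) (h0 : 0 ≤ r) (h1 : r ≤ 1) :
    0 < 4 * PP s r * EE s r - PE s r ^ 2 := by
  have c0 := det_c0 r h0 h1
  have c1 := det_c1 r h0 h1
  have c2 := det_c2 r h0 h1
  have c3 := det_c3 r h0 h1
  have c4 := det_c4 r h0 h1
  have c5 := det_c5 r h0 h1
  have c6 := det_c6 r h0 h1
  have c7 := det_c7 r h0 h1
  have c8 := det_c8 r h0 h1
  have c9 := det_c9 r h0 h1
  have c10 := det_c10 r h0 h1
  have c11 := det_c11 r h0 h1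
  have e : 4 * PP s r * EE s r - PE s r ^ 2 =
    ((644/25) * r ^ 0 + (-2316/25) * r ^ 1 + (2064/25) * r ^ 2 + (1352/25) * r ^ 3 + (-1604/25) * r ^ 4) * s ^ 0 +
    ((1508/5) * r ^ 0 + (-1931/2) * r ^ 1 + (90921/100) * r ^ 2 + (2288/5) * r ^ 3 + (-3252/5) * r ^ 4) * s ^ 1 +
    ((38821/25) * r ^ 0 + (-448763/100) * r ^ 1 + (21862/5) * r ^ 2 + (168581/100) * r ^ 3 + (-73221/25) * r ^ 4) * s ^ 2 +
    ((116404/25) * r ^ 0 + (-245201/20) * r ^ 1 + (303892/25) * r ^ 2 + (71219/20) * r ^ 3 + (-193309/25) * r ^ 4) * s ^ 3 +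
    ((225941/25) * r ^ 0 + (-545593/25) * r ^ 1 + (542971/25) * r ^ 2 + (119741/25) * r ^ 3 + (-332046/25) * r ^ 4) * s ^ 4 +
    ((297482/25) * r ^ 0 + (-105947/4) * r ^ 1 + (654036/25) * r ^ 2 + (8667/2) * r ^ 3 + (-388692/25) * r ^ 4) * s ^ 5 +
    ((269861/25) * r ^ 0 + (-556351/25) * r ^ 1 + (540891/25) * r ^ 2 + (137669/50) * r ^ 3 + (-315116/25) * r ^ 4) * s ^ 6 +
    ((167296/25) * r ^ 0 + (-1285139/100) * r ^ 1 + (306364/25) * r ^ 2 + (32422/25) * r ^ 3 + (-175746/25) * r ^ 4) * s ^ 7 +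
    ((68479/25) * r ^ 0 + (-123656/25) * r ^ 1 + (116263/25) * r ^ 2 + (12007/25) * r ^ 3 + (-65334/25) * r ^ 4) * s ^ 8 +
    ((17166/25) * r ^ 0 + (-118863/100) * r ^ 1 + (22567/20) * r ^ 2 + (6913/50) * r ^ 3 + (-15096/25) * r ^ 4) * s ^ 9 +
    ((2238/25) * r ^ 0 + (-3121/20) * r ^ 1 + (3993/25) * r ^ 2 + (105/4) * r ^ 3 + (-1863/25) * r ^ 4) * s ^ 10 +
    ((96/25) * r ^ 0 + (-8) * r ^ 1 + (261/25) * r ^ 2 + (9/4) * r ^ 3 + (-81/25) * r ^ 4) * s ^ 11 := by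
    unfold PP PE EE; ring
  rw [e]
  positivity

section core
variable {X Y : Type*} [NormedAddCommGroup X] [InnerProductSpace ℝ X]
  [NormedAddCommGroup Y] [InnerProductSpace ℝ Y]

lemma quad_nonneg (s r : ℝ) (hs : 0 ≤ s) (h0 : 0 ≤ r) (h1 : r ≤ 1) (p e : X) :
    0 ≤ PP s r * ‖p‖ ^ 2 + PE s r * ⟪p, e⟫ + EE s r * ‖e‖ ^ 2 := by
  have hp := PP_pos s r hs h0 h1
  have hd := det_pos s r hs h0 h1
  have hn : 0 ≤ ‖(2 * PP s r) • p + PE s r • e‖ ^ 2 := sq_nonneg _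
  rw [norm_add_sq_real, norm_smul, norm_smul, inner_smul_left, inner_smul_right, mul_pow, mul_pow,
    Real.norm_eq_abs, Real.norm_eq_abs, sq_abs, sq_abs] at hn
  simp only [conj_trivial] at hn
  have h2 := mul_nonneg hd.le (sq_nonneg ‖e‖)
  have : 0 ≤ (4 * PP s r) * (PP s r * ‖p‖ ^ 2 + PE s r * ⟪p, e⟫ + EE s r * ‖e‖ ^ 2) := by
    linear_combination hn + h2
  exact nonneg_of_mul_nonneg_right this (by positivity)

lemma vec_ident (DP DE VP VE : Y) (s r w : ℝ) (hs : 0 < s) (hw : w * (1 + s) = 1) :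
    ‖(2 + s) • DP + (s * w) • DE + (w * r) • VE‖ ^ 2
      + s * ‖(2 : ℝ) • DE - (2 : ℝ) • DP + r • VP + (2 * r / s) • VE‖ ^ 2
    = ‖(2 + s) • DP + (w * s) • DE‖ ^ 2 + w ^ 2 * r ^ 2 * ‖VE‖ ^ 2 + 4 * s * ‖DP - DE‖ ^ 2
      + 2 * r * ⟪(4 + w ^ 2 * s) • DE - ((2 + 3 * s) * w) • DP, VE⟫
      - 4 * r * s * ⟪DP - DE, VP⟫ + (4 * r ^ 2 / s) * ‖VE + (s / 2) • VP‖ ^ 2 := by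
  simp only [← real_inner_self_eq_norm_sq, inner_add_left, inner_add_right, inner_sub_left,
    inner_sub_right, inner_smul_left, inner_smul_right, conj_trivial]
  rw [real_inner_comm DP DE, real_inner_comm DP VE, real_inner_comm DP VP, real_inner_comm DE VE,
    real_inner_comm DE VP, real_inner_comm VP VE]
  have : s ≠ 0 := hs.ne'
  field_simp
  linear_combination (32 * r * s * ⟪DP, VE⟫) * hw

lemma main_ineq (V D : X →L[ℝ] Y) (s r w : ℝ) (hs : 0 < s) (h0 : 0 < r) (h1 : r ≤ 1)
    (hw : w * (1 + s) = 1) (hV : ∀ z, ‖V z‖ ^ 2 ≤ ‖z‖ ^ 2) (hD : ∀ z, ‖D z‖ ^ 2 ≤ 1 / 2 * ‖z‖ ^ 2)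
    (p e : X) :
    (PP s r * ‖p‖ ^ 2 + PE s r * ⟪p, e⟫ + EE s r * ‖e‖ ^ 2) / (1 + s) ^ 4
    + (‖(2 + s) • D p + (s * w) • D e + (w * r) • V e‖ ^ 2
      + s * ‖(2 : ℝ) • D e - (2 : ℝ) • D p + r • V p + (2 * r / s) • V e‖ ^ 2)
    ≤ ((2 + 3 * s) * (2 + s) * (2 - r ^ 2) - 2 * (23 / 20 - 21 / 20 * r ^ 2) * s * (2 + s)) * ‖p‖ ^ 2
      - 4 * (2 + s) * (23 / 20 - 21 / 20 * r ^ 2) * ⟪p, e⟫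
      + (2 * (2 + s) * (23 / 20 - 21 / 20 * r ^ 2) + r ^ 2 * ((2 + 3 * s) * (2 + s) / s)) * ‖e‖ ^ 2 := by
  rw [vec_ident _ _ _ _ s r w hs hw]
  have B1 := hD ((2 + s) • p + (w * s) • e)
  have B2 := hV e
  have B3 := hD (p - e)
  have B4 := hD ((4 + w ^ 2 * s) • e - ((2 + 3 * s) * w) • p)
  have B5 := hV p
  have B6 := hV (e + (s / 2) • p)
  simp only [map_add, map_sub, map_smul] at B1 B3 B4 B6
  have Y4 : 0 ≤ ‖((4 + w ^ 2 * s) • D e - ((2 + 3 * s) * w) • D p) - (5 / 2 : ℝ) • V e‖ ^ 2 :=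
    sq_nonneg _
  rw [norm_sub_sq_real, inner_smul_right, norm_smul, mul_pow, Real.norm_eq_abs, sq_abs] at Y4
  have Y5 : 0 ≤ ‖(D p - D e) + (8 / 5 : ℝ) • V p‖ ^ 2 := sq_nonneg _
  rw [norm_add_sq_real, inner_smul_right, norm_smul, mul_pow, Real.norm_eq_abs, sq_abs] at Y5
  generalize ‖(4 + w ^ 2 * s) • D e - ((2 + 3 * s) * w) • D p‖ ^ 2 = n4 at *
  generalize ⟪(4 + w ^ 2 * s) • D e - ((2 + 3 * s) * w) • D p, V e⟫ = i4 at *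
  generalize ‖D p - D e‖ ^ 2 = n5 at *
  generalize ⟪D p - D e, V p⟫ = i5 at *
  generalize ‖(2 + s) • D p + (w * s) • D e‖ ^ 2 = n1 at *
  generalize ‖V e + (s / 2) • V p‖ ^ 2 = n6 at *
  generalize ‖V e‖ ^ 2 = n2 at *
  generalize ‖V p‖ ^ 2 = n3 at *
  simp only [← real_inner_self_eq_norm_sq, inner_add_left, inner_add_right, inner_sub_left,
    inner_sub_right, inner_smul_left, inner_smul_right, conj_trivial] at B1 B2 B3 B4 B5 B6 ⊢
  rw [real_inner_comm p e] at B1 B3 B4 B6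
  generalize ⟪p, p⟫ = a at *
  generalize ⟪e, e⟫ = c at *
  generalize ⟪p, e⟫ = m at *
  have C2 := mul_le_mul_of_nonneg_left B2 (by positivity : 0 ≤ w ^ 2 * r ^ 2 + 5 / 2 * r)
  have C3 := mul_le_mul_of_nonneg_left B3 (by positivity : 0 ≤ 4 * s + 5 / 4 * r * s)
  have C4 := mul_le_mul_of_nonneg_left B4 (by positivity : 0 ≤ 2 / 5 * r)
  have C5 := mul_le_mul_of_nonneg_left B5 (by positivity : 0 ≤ 16 / 5 * r * s)
  have C6 := mul_le_mul_of_nonneg_left B6 (by positivity : 0 ≤ 4 * r ^ 2 / s)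
  have Z4 := mul_le_mul_of_nonneg_left Y4 (by positivity : 0 ≤ 2 / 5 * r)
  have Z5 := mul_le_mul_of_nonneg_left Y5 (by positivity : 0 ≤ 5 / 4 * r * s)
  have hw' : w = 1 / (1 + s) := by field_simp; exact hw
  have key := add_le_add B1 (add_le_add C2 (add_le_add C3 (add_le_add C4 (add_le_add C5
    (add_le_add C6 (add_le_add Z4 Z5))))))
  have hs' : s ≠ 0 := hs.ne'
  have hs1 : 1 + s ≠ 0 := by positivity
  rw [← sub_nonneg] at key ⊢
  refine key.trans_eq ?_
  subst hw'
  unfold PP PE EE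
  field_simp
  ring


/-- The remainder form. -/
noncomputable def Rem (V D : X →L[ℝ] Y) (s r w : ℝ) (p e : X) (z f : Y) : ℝ :=
  (1 - r ^ 2 / 2 - (23 / 20 - 21 / 20 * r ^ 2) / (2 + 3 * s) * s) * ‖p‖ ^ 2
  - 2 * ((23 / 20 - 21 / 20 * r ^ 2) / (2 + 3 * s)) * ⟪p, e⟫
  + (r ^ 2 / (2 * s) + (23 / 20 - 21 / 20 * r ^ 2) / (2 + 3 * s)) * ‖e‖ ^ 2
  + (2 + 3 * s) / (2 + s) / 2 * ‖z‖ ^ 2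
  + (2 + 3 * s) / (2 + s) / (2 * s) * ‖f‖ ^ 2
  - 1 / (2 + s) * ⟪(2 + s) • D p + (s * w) • D e + (w * r) • V e, z⟫
  + 1 / (2 + s) * ⟪(2 : ℝ) • D e - (2 : ℝ) • D p + r • V p + (2 * r / s) • V e, f⟫

/-- The Lyapunov function. -/
noncomputable def Phi (V D : X →L[ℝ] Y) (s r : ℝ) (x : X) (y : Y) : ℝ :=
  (r ^ 2 / (2 * s) + (23 / 20 - 21 / 20 * r ^ 2) / (2 + 3 * s)) * ‖x‖ ^ 2
  + (2 + 3 * s) / (2 + s) / (2 * s) * ‖y‖ ^ 2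
  - 2 / (2 + s) * ⟪D x + (r / s) • V x, y⟫

lemma elim_aux (a v : Y) (α β : ℝ) (hα : 0 < α) :
    - (β ^ 2 * ‖a‖ ^ 2 / (4 * α)) ≤ α * ‖v‖ ^ 2 + β * ⟪a, v⟫ := by
  have h : 0 ≤ ‖(2 * α) • v + β • a‖ ^ 2 := sq_nonneg _
  rw [norm_add_sq_real, norm_smul, norm_smul, inner_smul_left, inner_smul_right, mul_pow, mul_pow,
    Real.norm_eq_abs, Real.norm_eq_abs, sq_abs, sq_abs, real_inner_comm] at h
  simp only [conj_trivial] at h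
  rw [neg_le_iff_add_nonneg', ← sub_nonneg]
  have : β ^ 2 * ‖a‖ ^ 2 / (4 * α) + (α * ‖v‖ ^ 2 + β * ⟪a, v⟫) - 0 =
    ((2 * α) ^ 2 * ‖v‖ ^ 2 + 2 * (2 * α * (β * ⟪a, v⟫)) + β ^ 2 * ‖a‖ ^ 2) / (4 * α) := by
    field_simp; ring
  rw [this]
  exact div_nonneg h (by positivity)

lemma rem_lower (V D : X →L[ℝ] Y) (s r w : ℝ) (hs : 0 < s) (h0 : 0 < r) (h1 : r ≤ 1)
    (hw : w * (1 + s) = 1) (hV : ∀ z, ‖V z‖ ^ 2 ≤ ‖z‖ ^ 2) (hD : ∀ z, ‖D z‖ ^ 2 ≤ 1 / 2 * ‖z‖ ^ 2)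
    (p e : X) (z f : Y) :
    (PP s r * ‖p‖ ^ 2 + PE s r * ⟪p, e⟫ + EE s r * ‖e‖ ^ 2) / (1 + s) ^ 4
      / (2 * ((2 + 3 * s) * (2 + s))) ≤ Rem V D s r w p e z f := by
  have M := main_ineq V D s r w hs h0 h1 hw hV hD p e
  unfold Rem
  have E1 := elim_aux ((2 + s) • D p + (s * w) • D e + (w * r) • V e) z
    ((2 + 3 * s) / (2 + s) / 2) (- (1 / (2 + s))) (by positivity)
  have E2 := elim_aux ((2 : ℝ) • D e - (2 : ℝ) • D p + r • V p + (2 * r / s) • V e) f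
    ((2 + 3 * s) / (2 + s) / (2 * s)) (1 / (2 + s)) (by positivity)
  generalize (2 + s) • D p + (s * w) • D e + (w * r) • V e = u1 at *
  generalize (2 : ℝ) • D e - (2 : ℝ) • D p + r • V p + (2 * r / s) • V e = u2 at *
  generalize (PP s r * ‖p‖ ^ 2 + PE s r * ⟪p, e⟫ + EE s r * ‖e‖ ^ 2) / (1 + s) ^ 4 = Q at *
  have hc : 0 ≤ 1 / (2 * ((2 + 3 * s) * (2 + s))) := by positivity
  have M' := mul_le_mul_of_nonneg_left M hc
  have key := add_le_add M' (add_le_add E1 E2)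
  rw [← sub_nonneg] at key ⊢
  refine key.trans_eq ?_
  have : s ≠ 0 := hs.ne'
  field_simp
  ring

lemma step (V D : X →L[ℝ] Y) (s r w : ℝ) (hs : 0 < s) (h0 : 0 < r) (h1 : r ≤ 1)
    (hw : w * (1 + s) = 1) (hV : ∀ z, ‖V z‖ ^ 2 ≤ ‖z‖ ^ 2) (hD : ∀ z, ‖D z‖ ^ 2 ≤ 1 / 2 * ‖z‖ ^ 2)
    (p q : X) (z t : Y)
    (H1 : ‖p‖ ^ 2 ≤ r ^ 2 / s * ⟪q - p, p⟫ - r / s * ⟪V p, t⟫)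
    (H2 : ‖z‖ ^ 2 ≤ 1 / s * ⟪t - z, z⟫
      + ⟪D (p + w • (p - q)) + (r / s) • V (p + w • (p - q)), z⟫) :
    Phi V D s r p z ≤ w * Phi V D s r q t := by
  have hs1 : 0 < 1 + s := by positivity
  have hw' : w = 1 / (1 + s) := by field_simp; exact hw
  obtain ⟨e, rfl⟩ : ∃ e, q = p - e := ⟨p - q, by abel⟩
  obtain ⟨f, rfl⟩ : ∃ f, t = z + f := ⟨t - z, by abel⟩
  have R := (div_nonneg (div_nonneg (quad_nonneg s r hs.le h0.le h1 p e)
    (by positivity : 0 ≤ (1 + s) ^ 4)) (by positivity)).trans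
    (rem_lower V D s r w hs h0 h1 hw hV hD p e z f)
  have hl : 0 ≤ (2 + 3 * s) / (2 + s) := by positivity
  have H2' := mul_le_mul_of_nonneg_left H2 hl
  have key := add_le_add R (add_le_add H1 H2')
  suffices h : 0 ≤ Phi V D s r (p - e) (z + f) - (1 + s) * Phi V D s r p z by
    have h' := mul_nonneg (by rw [hw']; positivity : 0 ≤ w) h
    linear_combination h' - Phi V D s r p z * hw
  rw [← sub_nonneg] at key
  refine key.trans_eq ?_
  unfold Phi Rem
  simp only [← real_inner_self_eq_norm_sq, map_add, map_sub, map_smul, inner_add_left,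
    inner_add_right, inner_sub_left, smul_add, smul_sub,
    inner_sub_right, inner_smul_left, inner_smul_right, conj_trivial]
  rw [real_inner_comm p e, real_inner_comm z f]
  subst hw'
  have : s ≠ 0 := hs.ne'
  field_simp
  ring

lemma phi_lower (V D : X →L[ℝ] Y) (s r : ℝ) (hs : 0 < s) (h0 : 0 < r) (h1 : r ≤ 1)
    (hV : ∀ z, ‖V z‖ ^ 2 ≤ ‖z‖ ^ 2) (hD : ∀ z, ‖D z‖ ^ 2 ≤ 1 / 2 * ‖z‖ ^ 2) :
    ∃ C : ℝ, 0 ≤ C ∧ ∀ (x : X) (y : Y), ‖x‖ ^ 2 + ‖y‖ ^ 2 ≤ C * Phi V D s r x y := by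
  have hE := EE_pos s r hs.le h0.le h1
  set η := EE s r / (1 + s) ^ 4 / (2 * ((2 + 3 * s) * (2 + s))) with hη
  have hηp : 0 < η := by positivity
  have L1 : ∀ (x : X) (y : Y), η * ‖x‖ ^ 2 ≤ Phi V D s r x y := by
    intro x y
    have := rem_lower V D s r (1 / (1 + s)) hs h0 h1 (by field_simp) hV hD 0 x 0 (-y)
    refine (le_of_eq ?_).trans (this.trans (le_of_eq ?_))
    · simp [hη]; ring
    · simp only [Rem, Phi, map_zero, inner_zero_left, inner_zero_right, norm_zero, norm_neg,
        inner_neg_right, inner_add_left, inner_sub_left, inner_smul_left, smul_zero, conj_trivial]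
      field_simp
      ring
  set K := 1 + 2 * r ^ 2 / s ^ 2 with hK
  have L2 : ∀ x, ‖D x + (r / s) • V x‖ ^ 2 ≤ K * ‖x‖ ^ 2 := by
    intro x
    have a1 := hD x
    have a2 := mul_le_mul_of_nonneg_left (hV x) (by positivity : 0 ≤ 2 * (r / s) ^ 2)
    have a3 : 0 ≤ ‖D x - (r / s) • V x‖ ^ 2 := sq_nonneg _
    rw [norm_sub_sq_real, norm_smul, mul_pow, Real.norm_eq_abs, sq_abs] at a3
    rw [norm_add_sq_real, norm_smul, mul_pow, Real.norm_eq_abs, sq_abs]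
    have : K = 1 + 2 * (r / s) ^ 2 := by rw [hK]; ring
    rw [this]
    linarith
  have hd : 0 ≤ r ^ 2 / (2 * s) + (23 / 20 - 21 / 20 * r ^ 2) / (2 + 3 * s) := by
    have : 0 ≤ 23 / 20 - 21 / 20 * r ^ 2 := by nlinarith
    positivity
  set α := (2 + 3 * s) / (2 + s) / (2 * s) / 2 with hα
  have hαp : 0 < α := by positivity
  set B := (-(2 / (2 + s))) ^ 2 * K / (4 * α) with hB
  have hBp : 0 ≤ B := by positivity
  have L3 : ∀ (x : X) (y : Y), α * ‖y‖ ^ 2 ≤ Phi V D s r x y + B * ‖x‖ ^ 2 := by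
    intro x y
    have a1 := elim_aux (D x + (r / s) • V x) y α (-(2 / (2 + s))) hαp
    have a2 := mul_le_mul_of_nonneg_left (L2 x)
      (by positivity : 0 ≤ (-(2 / (2 + s))) ^ 2 / (4 * α))
    have a3 := mul_nonneg hd (sq_nonneg ‖x‖)
    have a4 : (2 + 3 * s) / (2 + s) / (2 * s) = 2 * α := by rw [hα]; ring
    unfold Phi
    rw [a4]
    have a5 : (-(2 / (2 + s))) ^ 2 / (4 * α) * (K * ‖x‖ ^ 2) = B * ‖x‖ ^ 2 := by rw [hB]; ring
    have a6 : (-(2 / (2 + s))) ^ 2 / (4 * α) * ‖D x + (r / s) • V x‖ ^ 2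
      = (-(2 / (2 + s))) ^ 2 * ‖D x + (r / s) • V x‖ ^ 2 / (4 * α) := by ring
    linarith
  refine ⟨1 / η + (1 + B / η) / α, by positivity, fun x y => ?_⟩
  have l1 := L1 x y
  have l3 := L3 x y
  have k1 : ‖x‖ ^ 2 ≤ Phi V D s r x y / η := by rw [le_div_iff₀ hηp]; linarith
  have k2 := mul_le_mul_of_nonneg_left k1 hBp
  have k3 : ‖y‖ ^ 2 ≤ (Phi V D s r x y + B * (Phi V D s r x y / η)) / α := by
    rw [le_div_iff₀ hαp]; linarith
  have : (1 / η + (1 + B / η) / α) * Phi V D s r x y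
    = Phi V D s r x y / η + (Phi V D s r x y + B * (Phi V D s r x y / η)) / α := by ring
  rw [this]; linarith

lemma normalized (V D : X →L[ℝ] Y) (s r w : ℝ) (hs : 0 < s) (h0 : 0 < r) (h1 : r ≤ 1)
    (hw : w * (1 + s) = 1) (hV : ∀ z, ‖V z‖ ^ 2 ≤ ‖z‖ ^ 2) (hD : ∀ z, ‖D z‖ ^ 2 ≤ 1 / 2 * ‖z‖ ^ 2)
    (p : ℕ → X) (z : ℕ → Y)
    (H1 : ∀ i, ‖p (i + 1)‖ ^ 2 ≤ r ^ 2 / s * ⟪p i - p (i + 1), p (i + 1)⟫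
      - r / s * ⟪V (p (i + 1)), z i⟫)
    (H2 : ∀ i, ‖z (i + 1)‖ ^ 2 ≤ 1 / s * ⟪z i - z (i + 1), z (i + 1)⟫
      + ⟪D (p (i + 1) + w • (p (i + 1) - p i))
        + (r / s) • V (p (i + 1) + w • (p (i + 1) - p i)), z (i + 1)⟫) :
    ∃ C : ℝ, 0 ≤ C ∧ ∀ N, ‖p N‖ ^ 2 + ‖z N‖ ^ 2 ≤ C * w ^ N := by
  obtain ⟨C, hC, hCl⟩ := phi_lower V D s r hs h0 h1 hV hD
  have hw0 : 0 ≤ w := by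
    have : 0 < w * (1 + s) := by rw [hw]; norm_num
    exact (pos_of_mul_pos_left this (by positivity)).le
  have hind : ∀ N, Phi V D s r (p N) (z N) ≤ Phi V D s r (p 0) (z 0) * w ^ N := by
    intro N
    induction N with
    | zero => simp
    | succ n ih =>
      have := step V D s r w hs h0 h1 hw hV hD _ _ _ _ (H1 n) (H2 n)
      have h2 := mul_le_mul_of_nonneg_left ih hw0
      calc _ ≤ _ := this
        _ ≤ _ := h2
        _ = _ := by ring
  refine ⟨C * Phi V D s r (p 0) (z 0), ?_, fun N => ?_⟩
  · exact le_trans (by positivity) (hCl (p 0) (z 0))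
  · calc _ ≤ _ := hCl (p N) (z N)
      _ ≤ _ := mul_le_mul_of_nonneg_left (hind N) hC
      _ = _ := by ring

lemma strong_mono {f : X → ℝ} {γ : ℝ} (hf : StronglyConvexWith γ f) {g g' x x' : X}
    (hg : HasSubgradientAt f g x) (hg' : HasSubgradientAt f g' x') :
    γ * ‖x - x'‖ ^ 2 ≤ ⟪g - g', x - x'⟫ := by
  -- sharpened subgradient inequality
  have sharp : ∀ {g x : X}, HasSubgradientAt f g x → ∀ u,
      f x + ⟪g, u - x⟫ + γ / 2 * ‖u - x‖ ^ 2 ≤ f u := by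
    intro g x hg u
    have hlim : ∀ t : ℝ, 0 < t → t ≤ 1 →
        f x + ⟪g, u - x⟫ + γ / 2 * (1 - t) * ‖u - x‖ ^ 2 ≤ f u := by
      intro t ht ht1
      have hc := hf.2 (Set.mem_univ x) (Set.mem_univ u) (sub_nonneg.2 ht1) ht.le (by ring)
      have hs := hg ((1 - t) • x + t • u)
      have e1 : (1 - t) • x + t • u - x = t • (u - x) := by module
      rw [e1, inner_smul_right] at hs
      simp only [smul_eq_mul] at hc
      have e2 : ‖(1 - t) • x + t • u‖ ^ 2
          = (1 - t) * ‖x‖ ^ 2 + t * ‖u‖ ^ 2 - t * (1 - t) * ‖u - x‖ ^ 2 := by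
        simp only [← real_inner_self_eq_norm_sq, inner_add_left, inner_add_right, inner_sub_left,
          inner_sub_right, inner_smul_left, inner_smul_right, conj_trivial]
        rw [real_inner_comm x u]
        ring
      rw [e2] at hc
      have : t * (f x + ⟪g, u - x⟫ + γ / 2 * (1 - t) * ‖u - x‖ ^ 2) ≤ t * f u := by
        linarith
      exact le_of_mul_le_mul_left this ht
    have hcont : Filter.Tendsto
        (fun t : ℝ => f x + ⟪g, u - x⟫ + γ / 2 * (1 - t) * ‖u - x‖ ^ 2)
        (nhdsWithin 0 (Set.Ioi 0))
        (nhds (f x + ⟪g, u - x⟫ + γ / 2 * (1 - 0) * ‖u - x‖ ^ 2)) := by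
      apply Filter.Tendsto.mono_left _ nhdsWithin_le_nhds
      apply Continuous.tendsto
      fun_prop
    have := le_of_tendsto hcont (by
      filter_upwards [Ioc_mem_nhdsGT (zero_lt_one (α := ℝ))] with t ht
      exact hlim t ht.1 ht.2)
    simpa using this
  have a := sharp hg x'
  have b := sharp hg' x
  rw [norm_sub_rev x' x] at a
  have : ⟪g, x' - x⟫ = -⟪g, x - x'⟫ := by rw [← inner_neg_right]; simp
  rw [inner_sub_left]
  linarith

end core

theorem statement9 {X Y : Type*}
    [NormedAddCommGroup X] [InnerProductSpace ℝ X] [CompleteSpace X]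
    [NormedAddCommGroup Y] [InnerProductSpace ℝ Y] [CompleteSpace Y]
    (A V : X →L[ℝ] Y) (hAV : 0 < ‖A - V‖) (hV : 0 < ‖V‖)
    (γG γF : ℝ) (hγG : 0 < γG) (hγF : 0 < γF)
    (hstrict : γF * γG > 2 * ‖A - V‖ ^ 2)
    (κ : ℝ) (hκ : κ ∈ Set.Ioo (0 : ℝ) 1)
    (b τ σ ω : ℝ)
    (hb : b = min (1 / 2) (min
      ((1 / κ) * (1 / 2 - ‖A - V‖ ^ 2 / (γF * γG)))
      ((1 - κ) / κ ^ 2 * (2 * ‖A - V‖ ^ 4 / (‖V‖ ^ 2 * γF * γG)))))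
    (hτ : τ = Real.sqrt ((1 - κ) * γF / (2 * b * ‖V‖ ^ 2 * γG)))
    (hσ : σ = 2 * b * (γG / γF) * τ)
    (hω : ω = 1 / (1 + 2 * b * τ * γG))
    (G : X → ℝ) (Fstar : Y → ℝ)
    (hG : StronglyConvexWith γG G)
    (hFstar : StronglyConvexWith γF Fstar)
    (x : ℕ → X) (y : ℕ → Y)
    (hx : ∀ i, HasSubgradientAt G
      ((1 / τ) • (x i - x (i + 1)) - ContinuousLinearMap.adjoint V (y i)) (x (i + 1)))
    (hy : ∀ i, HasSubgradientAt Fstar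
      ((1 / σ) • (y i - y (i + 1)) + A (x (i + 1) + ω • (x (i + 1) - x i))) (y (i + 1)))
    (xh : X) (yh : Y)
    (hxh : HasSubgradientAt G (-(ContinuousLinearMap.adjoint V yh)) xh)
    (hyh : HasSubgradientAt Fstar (A xh) yh) :
    ∃ C : ℝ, 0 ≤ C ∧ ∀ N : ℕ, ‖x N - xh‖ ^ 2 + ‖y N - yh‖ ^ 2 ≤ C * ω ^ N := by
  obtain ⟨hκ0, hκ1⟩ := hκ
  have hnn : 0 < γF * γG := by positivity
  have h1κ : 0 < 1 - κ := by linarith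
  have hb0 : 0 < b := by
    rw [hb]
    refine lt_min (by norm_num) (lt_min ?_ ?_)
    · have : ‖A - V‖ ^ 2 / (γF * γG) < 1 / 2 := by
        rw [div_lt_iff₀ hnn]; linarith
      have : 0 < 1 / 2 - ‖A - V‖ ^ 2 / (γF * γG) := by linarith
      positivity
    · positivity
  have hb1 : b ≤ 1 / 2 := by rw [hb]; exact min_le_left _ _
  clear hb
  have hτ0 : 0 < τ := by rw [hτ]; apply Real.sqrt_pos.2; positivity
  have hτ2 : τ ^ 2 = (1 - κ) * γF / (2 * b * ‖V‖ ^ 2 * γG) := by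
    rw [hτ, Real.sq_sqrt]; positivity
  clear hτ
  obtain ⟨gG, hgG0, rfl⟩ : ∃ g : ℝ, 0 < g ∧ γG = g ^ 2 :=
    ⟨Real.sqrt γG, Real.sqrt_pos.2 hγG, (Real.sq_sqrt hγG.le).symm⟩
  obtain ⟨gF, hgF0, rfl⟩ : ∃ g : ℝ, 0 < g ∧ γF = g ^ 2 :=
    ⟨Real.sqrt γF, Real.sqrt_pos.2 hγF, (Real.sq_sqrt hγF.le).symm⟩
  obtain ⟨r, hr0, hr2⟩ : ∃ r : ℝ, 0 < r ∧ r ^ 2 = 2 * b :=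
    ⟨Real.sqrt (2 * b), Real.sqrt_pos.2 (by positivity), Real.sq_sqrt (by positivity)⟩
  have hr1 : r ≤ 1 := by nlinarith
  obtain rfl : b = r ^ 2 / 2 := by linarith
  clear hr2
  obtain ⟨s, hs⟩ : ∃ s : ℝ, s = r ^ 2 * τ * gG ^ 2 := ⟨_, rfl⟩
  have hs0 : 0 < s := by rw [hs]; positivity
  have hσs : σ = s / gF ^ 2 := by rw [hσ, hs]; field_simp
  have hωs : ω * (1 + s) = 1 := by
    have : 1 + 2 * (r ^ 2 / 2) * τ * gG ^ 2 = 1 + s := by rw [hs]; ring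
    rw [hω, this]; field_simp
  have hτs : 1 / τ = r ^ 2 / s * gG ^ 2 := by rw [hs]; field_simp
  have hVb : ∀ z, ‖((s / (r * (gG * gF))) • V) z‖ ^ 2 ≤ ‖z‖ ^ 2 := by
    intro z
    have h1 : ‖V z‖ ^ 2 ≤ (‖V‖ * ‖z‖) ^ 2 := by
      gcongr; exact V.le_opNorm z
    have h2 : (s / (r * (gG * gF))) ^ 2 * ‖V‖ ^ 2 = 1 - κ := by
      have : (s / (r * (gG * gF))) ^ 2 = τ ^ 2 * (r ^ 2 * gG ^ 2 / gF ^ 2) := by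
        rw [hs]; field_simp
      rw [this, hτ2]
      field_simp
    rw [ContinuousLinearMap.smul_apply, norm_smul, mul_pow, Real.norm_eq_abs, sq_abs]
    calc _ ≤ (s / (r * (gG * gF))) ^ 2 * (‖V‖ * ‖z‖) ^ 2 := by gcongr
      _ = (1 - κ) * ‖z‖ ^ 2 := by rw [← h2]; ring
      _ ≤ 1 * ‖z‖ ^ 2 := by gcongr; linarith
      _ = _ := one_mul _
  have hDb : ∀ z, ‖((1 / (gG * gF)) • (A - V)) z‖ ^ 2 ≤ 1 / 2 * ‖z‖ ^ 2 := by
    intro z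
    have h1 : ‖(A - V) z‖ ^ 2 ≤ (‖A - V‖ * ‖z‖) ^ 2 := by
      gcongr; exact (A - V).le_opNorm z
    rw [ContinuousLinearMap.smul_apply, norm_smul, mul_pow, Real.norm_eq_abs, sq_abs]
    have h2 : (1 / (gG * gF)) ^ 2 * ‖A - V‖ ^ 2 ≤ 1 / 2 := by
      have : (1 / (gG * gF)) ^ 2 * ‖A - V‖ ^ 2 = ‖A - V‖ ^ 2 / (gF ^ 2 * gG ^ 2) := by
        field_simp
      rw [this, div_le_iff₀ hnn]; linarith
    calc _ ≤ (1 / (gG * gF)) ^ 2 * (‖A - V‖ * ‖z‖) ^ 2 := by gcongr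
      _ = ((1 / (gG * gF)) ^ 2 * ‖A - V‖ ^ 2) * ‖z‖ ^ 2 := by ring
      _ ≤ _ := by gcongr
  have hnorm := normalized ((s / (r * (gG * gF))) • V) ((1 / (gG * gF)) • (A - V)) s r ω hs0 hr0 hr1
    hωs hVb hDb (fun i => gG • (x i - xh)) (fun i => gF • (y i - yh)) ?_ ?_
  · obtain ⟨C, hC, hN⟩ := hnorm
    have hω0 : 0 < ω := by
      have : 0 < ω * (1 + s) := by rw [hωs]; norm_num
      exact pos_of_mul_pos_left this (by positivity)
    refine ⟨C / gG ^ 2 + C / gF ^ 2, by positivity, fun N => ?_⟩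
    have h := hN N
    simp only [norm_smul, mul_pow, Real.norm_eq_abs, sq_abs] at h
    have k1 : ‖x N - xh‖ ^ 2 ≤ C * ω ^ N / gG ^ 2 := by
      rw [le_div_iff₀ (by positivity)]
      have : 0 ≤ gF ^ 2 * ‖y N - yh‖ ^ 2 := by positivity
      linarith
    have k2 : ‖y N - yh‖ ^ 2 ≤ C * ω ^ N / gF ^ 2 := by
      rw [le_div_iff₀ (by positivity)]
      have : 0 ≤ gG ^ 2 * ‖x N - xh‖ ^ 2 := by positivity
      linarith
    calc _ ≤ _ := add_le_add k1 k2
      _ = _ := by ring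
  · intro i
    have h := strong_mono hG (hx i) hxh
    have e1 : (1 / τ) • (x i - x (i + 1)) - ContinuousLinearMap.adjoint V (y i)
        - -(ContinuousLinearMap.adjoint V yh)
        = (1 / τ) • (x i - x (i + 1)) - ContinuousLinearMap.adjoint V (y i - yh) := by
      rw [map_sub]; abel
    rw [e1, inner_sub_left, ContinuousLinearMap.adjoint_inner_left, inner_smul_left, hτs,
      real_inner_comm] at h
    have e2 : gG • (x i - xh) - gG • (x (i + 1) - xh) = gG • (x i - x (i + 1)) := by
      module
    simp only [e2, norm_smul, mul_pow, Real.norm_eq_abs, sq_abs, inner_smul_left, inner_smul_right,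
      ContinuousLinearMap.smul_apply, map_smul, conj_trivial] at h ⊢
    rw [real_inner_comm (x i - x (i + 1)) (x (i + 1) - xh)] at h
    rw [real_inner_comm (y i - yh) (V (x (i + 1) - xh))]
    refine h.trans (le_of_eq ?_)
    field_simp
  · intro i
    have h := strong_mono hFstar (hy i) hyh
    have e1 : (1 / σ) • (y i - y (i + 1)) + A (x (i + 1) + ω • (x (i + 1) - x i)) - A xh
        = (1 / σ) • (y i - y (i + 1)) + A (x (i + 1) - xh + ω • (x (i + 1) - x i)) := by
      simp only [map_add, map_sub]; abel
    rw [e1, inner_add_left, inner_smul_left] at h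
    have e2 : gF • (y i - yh) - gF • (y (i + 1) - yh) = gF • (y i - y (i + 1)) := by
      module
    have e3 : gG • (x (i + 1) - xh) + ω • (gG • (x (i + 1) - xh) - gG • (x i - xh))
        = gG • (x (i + 1) - xh + ω • (x (i + 1) - x i)) := by
      module
    have e4 : ∀ u : X, ((1 / (gG * gF)) • (A - V)) (gG • u)
        + (r / s) • ((s / (r * (gG * gF))) • V) (gG • u) = (1 / gF) • A u := by
      intro u
      simp only [ContinuousLinearMap.smul_apply, ContinuousLinearMap.sub_apply, map_smul,
        smul_smul, smul_sub]
      have a1 : gG * (1 / (gG * gF)) = 1 / gF := by field_simp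
      have a2 : r / s * (gG * (s / (r * (gG * gF)))) = 1 / gF := by field_simp
      rw [a1, a2]; abel
    simp only [e2, e3, e4, norm_smul, mul_pow, Real.norm_eq_abs, sq_abs, inner_smul_left,
      inner_smul_right, conj_trivial] at h ⊢
    refine h.trans (le_of_eq ?_)
    rw [hσs]
    field_simp
end

section
/- Let n ≥ 1, α, τ, σ > 0, and let x, y : ℕ → ℝⁿ be sequences satisfying, for all i ∈ ℕ and all coordinates j, x^{i+1}_j = x^i_j + ατ y^i_j and y^{i+1}_j = max(−1, min(1, y^i_j + σ(2x^{i+1}_j − x^i_j))). If x^0_j > 0 and y^0_j > 0 for every coordinate j, then for all i and all j one has x^i_j > 0, y^i_j > 0 and x^{i+1}_j > x^i_j; in particular, the sequence (x^i) does not converge to 0. -/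
theorem statement11 (n : ℕ) (hn : 1 ≤ n) (α τ σ : ℝ)
    (hα : 0 < α) (hτ : 0 < τ) (hσ : 0 < σ)
    (x y : ℕ → Fin n → ℝ)
    (hx : ∀ (i : ℕ) (j : Fin n), x (i + 1) j = x i j + α * τ * y i j)
    (hy : ∀ (i : ℕ) (j : Fin n),
      y (i + 1) j = max (-1) (min 1 (y i j + σ * (2 * x (i + 1) j - x i j))))
    (hx0 : ∀ j : Fin n, 0 < x 0 j) (hy0 : ∀ j : Fin n, 0 < y 0 j) :
    (∀ (i : ℕ) (j : Fin n), 0 < x i j ∧ 0 < y i j ∧ x i j < x (i + 1) j) ∧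
      ¬ Filter.Tendsto x Filter.atTop (nhds 0) := by
  have step : ∀ (i : ℕ) (j : Fin n), 0 < y i j → x i j < x (i + 1) j := by
    intro i j h
    have h1 : 0 < α * τ * y i j := by positivity
    rw [hx i j]
    linarith
  have key : ∀ (i : ℕ) (j : Fin n), 0 < x i j ∧ 0 < y i j := by
    intro i j
    induction i with
    | zero => exact ⟨hx0 j, hy0 j⟩
    | succ i ih =>
      obtain ⟨h1, h2⟩ := ih
      have h3 := step i j h2
      refine ⟨by linarith, ?_⟩
      rw [hy i j]
      have h4 : 0 < σ * (2 * x (i + 1) j - x i j) := mul_pos hσ (by linarith)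
      exact lt_max_of_lt_right (lt_min one_pos (by linarith))
  refine ⟨fun i j => ⟨(key i j).1, (key i j).2, step i j (key i j).2⟩, fun ht => ?_⟩
  let j : Fin n := ⟨0, hn⟩
  have hj : Filter.Tendsto (fun i => x i j) Filter.atTop (nhds 0) := (tendsto_pi_nhds.1 ht) j
  have hm : Monotone (fun i => x i j) :=
    monotone_nat_of_le_succ fun i => (step i j (key i j).2).le
  have h0 : x 0 j ≤ 0 := hm.ge_of_tendsto hj 0
  exact absurd (hx0 j) (not_lt.2 h0)
end

section
/- Let τ : ℕ → ℝ satisfy τ_0 > 0 and τ_{i+1} = τ_i/√(1 + 2τ_i) for all i ∈ ℕ. Then τ_i > 0 for all i, 1/τ_{i+1} ≤ 1 + 1/τ_i for all i, consequently τ_i ≥ 1/(i + 1/τ_0) for all i, and the series Σ_{i=0}^∞ τ_i diverges to +∞. -/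
theorem statement12 (τ : ℕ → ℝ) (hτ0 : 0 < τ 0)
    (hrec : ∀ i : ℕ, τ (i + 1) = τ i / Real.sqrt (1 + 2 * τ i)) :
    (∀ i : ℕ, 0 < τ i) ∧
      (∀ i : ℕ, 1 / τ (i + 1) ≤ 1 + 1 / τ i) ∧
      (∀ i : ℕ, 1 / ((i : ℝ) + 1 / τ 0) ≤ τ i) ∧
      Filter.Tendsto (fun N : ℕ => ∑ i ∈ Finset.range N, τ i) Filter.atTop Filter.atTop := by
  have hpos : ∀ i : ℕ, 0 < τ i := by
    intro i
    induction i with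
    | zero => exact hτ0
    | succ k ih =>
      rw [hrec]
      exact div_pos ih (Real.sqrt_pos.mpr (by linarith))
  have hstep : ∀ i : ℕ, 1 / τ (i + 1) ≤ 1 + 1 / τ i := by
    intro i
    have hp := hpos i
    have hs : Real.sqrt (1 + 2 * τ i) ≤ 1 + τ i :=
      Real.sqrt_le_iff.mpr ⟨by linarith, by nlinarith⟩
    have he : 1 + 1 / τ i = (1 + τ i) / τ i := by
      field_simp
      ring
    rw [hrec, one_div_div, he]
    gcongr
  have hinv : ∀ i : ℕ, 1 / τ i ≤ (i : ℝ) + 1 / τ 0 := by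
    intro i
    induction i with
    | zero => simp
    | succ k ih =>
      have := hstep k
      push_cast
      linarith
  have hlow : ∀ i : ℕ, 1 / ((i : ℝ) + 1 / τ 0) ≤ τ i := by
    intro i
    have hp := hpos i
    have := one_div_le_one_div_of_le (one_div_pos.mpr hp) (hinv i)
    rwa [one_div_one_div] at this
  refine ⟨hpos, hstep, hlow, ?_⟩
  rw [← not_summable_iff_tendsto_nat_atTop_of_nonneg (fun i => (hpos i).le)]
  intro hsum
  obtain ⟨M, hM⟩ := exists_nat_ge (1 / τ 0)
  have h0 : 0 < 1 / τ 0 := one_div_pos.mpr hτ0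
  have h2 : Summable (fun i : ℕ => 1 / (((i + M : ℕ)) : ℝ)) := by
    refine Summable.of_nonneg_of_le (fun i => by positivity) (fun i => ?_) hsum
    refine le_trans ?_ (hlow i)
    have : (0 : ℝ) ≤ i := Nat.cast_nonneg i
    apply one_div_le_one_div_of_le
    · linarith
    · push_cast
      linarith
  exact Real.not_summable_one_div_natCast
    ((summable_nat_add_iff (f := fun n : ℕ => 1 / (n : ℝ)) M).mp h2)
end

section
/- Let z ∈ ℝ with z ≠ 0 and τ_0, σ_0 > 0. Define θ_i = 1/√(1 + 2τ_i), τ_{i+1} = θ_i τ_i, σ_{i+1} = σ_i/θ_i for all i ∈ ℕ. Let x : ℕ → ℝ² and y : ℕ → ℝ satisfy x^0 = (0, 0), y^0 = −z, and for all i: x^{i+1} = x^i − τ_i·(y^i, −y^i) and y^{i+1} = (y^i + σ_{i+1}·[s^{i+1} + θ_i(s^{i+1} − s^i)] − σ_{i+1} z)/(1 + σ_{i+1}), where s^i := x^i_1 + x^i_2. Then for all n ∈ ℕ: y^n = −z and x^n = (Σ_{i=0}^{n−1} τ_i)·(z, −z); moreover ‖x^n‖ → ∞ as n → ∞. -/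
theorem statement13 (z : ℝ) (hz : z ≠ 0)
    (τ σ θ : ℕ → ℝ) (hτ0 : 0 < τ 0) (hσ0 : 0 < σ 0)
    (hθ : ∀ i : ℕ, θ i = 1 / Real.sqrt (1 + 2 * τ i))
    (hτ : ∀ i : ℕ, τ (i + 1) = θ i * τ i)
    (hσ : ∀ i : ℕ, σ (i + 1) = σ i / θ i)
    (x : ℕ → ℝ × ℝ) (y : ℕ → ℝ)
    (hx0 : x 0 = (0, 0)) (hy0 : y 0 = -z)
    (hx : ∀ i : ℕ, x (i + 1) = x i - τ i • (y i, -(y i)))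
    (hy : ∀ i : ℕ,
      y (i + 1) = (y i
          + σ (i + 1) * (((x (i + 1)).1 + (x (i + 1)).2)
              + θ i * (((x (i + 1)).1 + (x (i + 1)).2) - ((x i).1 + (x i).2)))
          - σ (i + 1) * z) / (1 + σ (i + 1))) :
    (∀ n : ℕ, y n = -z ∧ x n = (∑ i ∈ Finset.range n, τ i) • ((z, -z) : ℝ × ℝ)) ∧
      Filter.Tendsto (fun n : ℕ => ‖x n‖) Filter.atTop Filter.atTop := by
  have hτpos : ∀ n, 0 < τ n := by
    intro n
    induction n with
    | zero => exact hτ0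
    | succ n ih =>
      rw [hτ, hθ]
      positivity
  have hθpos : ∀ n, 0 < θ n := by
    intro n
    have := hτpos n
    rw [hθ]
    positivity
  have hσpos : ∀ n, 0 < σ n := by
    intro n
    induction n with
    | zero => exact hσ0
    | succ n ih =>
      rw [hσ]
      exact div_pos ih (hθpos n)
  have main : ∀ n : ℕ, y n = -z ∧
      x n = (∑ i ∈ Finset.range n, τ i) • ((z, -z) : ℝ × ℝ) := by
    intro n
    induction n with
    | zero => exact ⟨hy0, by simp [hx0]⟩
    | succ n ih =>
      obtain ⟨h1, h2⟩ := ih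
      have h3 : x (n + 1) = (∑ i ∈ Finset.range (n + 1), τ i) • ((z, -z) : ℝ × ℝ) := by
        rw [hx, h1, h2, Finset.sum_range_succ]
        ext <;> simp <;> ring
      refine ⟨?_, h3⟩
      have hs := hσpos (n + 1)
      rw [hy, h3, h2, h1]
      simp only [Prod.smul_mk, smul_eq_mul]
      rw [div_eq_iff (by positivity)]
      ring
  refine ⟨main, ?_⟩
  obtain ⟨k, hk⟩ := exists_nat_ge (1 / τ 0)
  have hlow : ∀ n : ℕ, 1 ≤ τ n * ((n : ℝ) + k) := by
    intro n
    induction n with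
    | zero =>
      rw [div_le_iff₀ hτ0] at hk
      simp only [Nat.cast_zero, zero_add]
      linarith
    | succ n ih =>
      have ht := hτpos n
      have hsq : Real.sqrt (1 + 2 * τ n) ≤ 1 + τ n := by
        rw [Real.sqrt_le_left (by positivity)]
        nlinarith [sq_nonneg (τ n)]
      have hsp : 0 < Real.sqrt (1 + 2 * τ n) := by positivity
      rw [hτ, hθ, one_div, inv_mul_eq_div, div_mul_eq_mul_div, le_div_iff₀ hsp]
      push_cast
      linarith
  have hns : ¬ Summable τ := by
    intro h
    have h2 : Summable (fun n : ℕ => 1 / (((n + k : ℕ) : ℝ))) := by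
      refine Summable.of_nonneg_of_le (fun n => by positivity) (fun n => ?_) h
      have h3 := hlow n
      have hp : 0 < ((n : ℝ) + k) := by
        by_contra hc
        have := mul_nonpos_of_nonneg_of_nonpos (hτpos n).le (not_lt.mp hc)
        linarith
      push_cast
      rwa [div_le_iff₀ hp]
    exact Real.not_summable_one_div_natCast
      ((summable_nat_add_iff (f := fun n : ℕ => 1 / (n : ℝ)) k).mp h2)
  have hT := (not_summable_iff_tendsto_nat_atTop_of_nonneg (fun n => (hτpos n).le)).mp hns
  have hnorm : ∀ n, ‖x n‖ = (∑ i ∈ Finset.range n, τ i) * |z| := by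
    intro n
    have h0 : 0 ≤ ∑ i ∈ Finset.range n, τ i := Finset.sum_nonneg (fun i _ => (hτpos i).le)
    rw [(main n).2, norm_smul, Real.norm_of_nonneg h0]
    simp [Prod.norm_def]
  simp only [hnorm]
  exact hT.atTop_mul_const (abs_pos.mpr hz)
end

section
/- Let m, n ∈ ℕ, let A, V be real m × n matrices, α, β > 0, z ∈ ℝ^m, and suppose the m × m matrix αβ·I + A·Vᵀ is invertible. Define w = (αβ·I + A·Vᵀ)⁻¹ z, x̂ = Vᵀ·w ∈ ℝⁿ and ŷ = −α·w ∈ ℝ^m. Then α·x̂ + Vᵀ·ŷ = 0 and A·x̂ = β·ŷ + z. Moreover, if additionally the n × n matrix α·I + β⁻¹·Vᵀ·A is invertible, then x̂ = (α·I + β⁻¹·Vᵀ·A)⁻¹·(β⁻¹·Vᵀ·z). -/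
open Matrix

theorem statement14 (m n : ℕ)
    (A V : Matrix (Fin m) (Fin n) ℝ) (α β : ℝ) (hα : 0 < α) (hβ : 0 < β)
    (z : Fin m → ℝ)
    (hinv : IsUnit ((α * β) • (1 : Matrix (Fin m) (Fin m) ℝ) + A * Vᵀ))
    (w : Fin m → ℝ) (xh : Fin n → ℝ) (yh : Fin m → ℝ)
    (hw : w = ((α * β) • (1 : Matrix (Fin m) (Fin m) ℝ) + A * Vᵀ)⁻¹ *ᵥ z)
    (hxh : xh = Vᵀ *ᵥ w) (hyh : yh = (-α) • w) :
    α • xh + Vᵀ *ᵥ yh = 0 ∧ A *ᵥ xh = β • yh + z ∧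
      (IsUnit (α • (1 : Matrix (Fin n) (Fin n) ℝ) + β⁻¹ • (Vᵀ * A)) →
        xh = (α • (1 : Matrix (Fin n) (Fin n) ℝ) + β⁻¹ • (Vᵀ * A))⁻¹ *ᵥ
          (β⁻¹ • (Vᵀ *ᵥ z))) := by
  have hz : (α * β) • w + A *ᵥ xh = z := by
    have h : ((α * β) • (1 : Matrix (Fin m) (Fin m) ℝ) + A * Vᵀ) *ᵥ w = z := by
      rw [hw, mulVec_mulVec, Matrix.mul_nonsing_inv _ ((Matrix.isUnit_iff_isUnit_det _).1 hinv),
        one_mulVec]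
    rw [add_mulVec, smul_mulVec, one_mulVec, ← mulVec_mulVec, ← hxh] at h
    exact h
  have h1 : α • xh + Vᵀ *ᵥ yh = 0 := by
    rw [hyh, mulVec_smul, ← hxh, neg_smul, add_neg_cancel]
  have h2 : A *ᵥ xh = β • yh + z := by
    rw [← hz, hyh, smul_smul, ← add_assoc, ← add_smul]
    have : β * -α + α * β = 0 := by ring
    rw [this, zero_smul, zero_add]
  refine ⟨h1, h2, fun hu => ?_⟩
  have h3 : (α • (1 : Matrix (Fin n) (Fin n) ℝ) + β⁻¹ • (Vᵀ * A)) *ᵥ xh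
      = β⁻¹ • (Vᵀ *ᵥ z) := by
    rw [add_mulVec, smul_mulVec, one_mulVec, smul_mulVec, ← mulVec_mulVec, h2,
      mulVec_add, smul_add, mulVec_smul, smul_smul, inv_mul_cancel₀ hβ.ne', one_smul,
      ← add_assoc, h1, zero_add]
  rw [← h3, mulVec_mulVec, Matrix.nonsing_inv_mul _ ((Matrix.isUnit_iff_isUnit_det _).1 hu),
    one_mulVec]
end
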